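/- Let m ≥ 3. The number r_0(m) of ranking patterns of unidimensional unfolding models with generic m-tuples satisfying x_1 < ⋯ < x_m equals |ch(M_m)| / m!, the number of chambers of the mid-hyperplane arrangement M_m divided by m!. -/

import Mathlib

/-- The union of the hyperplanes of the braid arrangement `B_m` in `ℝ^m`:
`x_i = x_j` for `1 ≤ i < j ≤ m`. -/
def braidUnion (m : ℕ) : Set (Fin m → ℝ) :=
  ⋃ i : Fin m, ⋃ j : Fin m, ⋃ _ : i < j, {x | x i = x j}

/-- The union of the hyperplanes of the arrangement `N_m` in `ℝ^m`:
`x_i + x_j = x_k + x_l` for quadruples of distinct indices `(i,j,k,l)` with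
`i < j`, `i < k < l`. -/
def midUnion (m : ℕ) : Set (Fin m → ℝ) :=
  ⋃ i : Fin m, ⋃ j : Fin m, ⋃ k : Fin m, ⋃ l : Fin m,
    ⋃ _ : i < j, ⋃ _ : i < k, ⋃ _ : k < l, ⋃ _ : j ≠ k, ⋃ _ : j ≠ l,
      {x | x i + x j = x k + x l}

/-- The union of the hyperplanes of the mid-hyperplane arrangement
`M_m = B_m ∪ N_m`. -/
def midHyperplaneUnion (m : ℕ) : Set (Fin m → ℝ) :=
  braidUnion m ∪ midUnion m

/-- The chamber `C_0 = {x : x_1 < ⋯ < x_m}` of the braid arrangement. -/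
def C0 (m : ℕ) : Set (Fin m → ℝ) := {x | StrictMono x}

/-- The ranking pattern of the unidimensional unfolding model with objects
`x_1, …, x_m ∈ ℝ`: the set of rankings `(i_1 ⋯ i_m)` (permutations of
`{1,…,m}`, where `σ k = i_k`) such that
`|y - x_{i_1}| < ⋯ < |y - x_{i_m}|` for some `y ∈ ℝ`. -/
def RPUF {m : ℕ} (x : Fin m → ℝ) : Set (Equiv.Perm (Fin m)) :=
  {σ | ∃ y : ℝ, ∀ k l : Fin m, k < l → |y - x (σ k)| < |y - x (σ l)|}

/-- The chambers of an arrangement with union of hyperplanes `U`: the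
connected components of the complement of `U`. -/
def chambersOf {m : ℕ} (U : Set (Fin m → ℝ)) : Set (Set (Fin m → ℝ)) :=
  {C | ∃ y ∈ Uᶜ, C = connectedComponentIn Uᶜ y}

/-- `r_0(m)`: the number of ranking patterns of unidimensional unfolding
models with generic `m`-tuples such that `x_1 < ⋯ < x_m`. -/
noncomputable def r0 (m : ℕ) : ℕ :=
  {R : Set (Equiv.Perm (Fin m)) | ∃ x ∈ C0 m \ midUnion m, R = RPUF x}.ncard

/-- The comparisons between midpoints of pairs of distinct coordinates of `x`: the quadruples
`((i, j), (k, l))` with `i ≠ j`, `k ≠ l` and `x_i + x_j < x_k + x_l`. -/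
def midOrder {m : ℕ} (x : Fin m → ℝ) : Set ((Fin m × Fin m) × (Fin m × Fin m)) :=
  {q | q.1.1 ≠ q.1.2 ∧ q.2.1 ≠ q.2.2 ∧ x q.1.1 + x q.1.2 < x q.2.1 + x q.2.2}

theorem mem_midOrder {m : ℕ} {x : Fin m → ℝ} {i j k l : Fin m} :
    ((i, j), (k, l)) ∈ midOrder x ↔ i ≠ j ∧ k ≠ l ∧ x i + x j < x k + x l := Iff.rfl

theorem midOrder_eq_iff {m : ℕ} {x x' : Fin m → ℝ} :
    midOrder x = midOrder x' ↔ ∀ i j k l : Fin m, i ≠ j → k ≠ l →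
      (x i + x j < x k + x l ↔ x' i + x' j < x' k + x' l) := by
  constructor
  · intro h i j k l hij hkl
    have := Set.ext_iff.1 h ((i, j), (k, l))
    simpa [mem_midOrder, hij, hkl] using this
  · intro h
    ext ⟨⟨i, j⟩, ⟨k, l⟩⟩
    simp only [mem_midOrder]
    refine and_congr_right fun hij => and_congr_right fun hkl => h i j k l hij hkl

theorem midOrder_eq_iff_of_lt {m : ℕ} {x x' : Fin m → ℝ} :
    midOrder x = midOrder x' ↔ ∀ i j k l : Fin m, i < j → k < l →
      (x i + x j < x k + x l ↔ x' i + x' j < x' k + x' l) := by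
  rw [midOrder_eq_iff]
  refine ⟨fun h i j k l hij hkl => h i j k l hij.ne hkl.ne, fun h i j k l hij hkl => ?_⟩
  rcases hij.lt_or_gt with h1 | h1 <;> rcases hkl.lt_or_gt with h2 | h2
  · exact h i j k l h1 h2
  · simpa only [add_comm] using h i j l k h1 h2
  · simpa only [add_comm] using h j i k l h1 h2
  · simpa only [add_comm] using h j i l k h1 h2

theorem exists_ne_ne {m : ℕ} (hm : 3 ≤ m) (i j : Fin m) : ∃ k, k ≠ i ∧ k ≠ j := by
  have : ({i, j} : Finset (Fin m)).card < Fintype.card (Fin m) := by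
    have := Finset.card_le_two (a := i) (b := j)
    simp only [Fintype.card_fin]
    omega
  obtain ⟨k, hk⟩ := Finset.exists_mem_notMem_of_card_lt_card
    (s := {i, j}) (t := Finset.univ) (by simpa using this)
  exact ⟨k, by simpa using hk⟩

theorem notMem_braidUnion_iff {m : ℕ} {x : Fin m → ℝ} :
    x ∉ braidUnion m ↔ Function.Injective x := by
  simp only [braidUnion, Set.mem_iUnion, Set.mem_ofPred_eq, not_exists]
  constructor
  · intro h i j hij
    by_contra hne
    rcases lt_or_gt_of_ne hne with h1 | h1
    · exact h i j h1 hij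
    · exact h j i h1 hij.symm
  · intro h i j hij he
    exact hij.ne (h he)

theorem notMem_midUnion_iff {m : ℕ} {x : Fin m → ℝ} :
    x ∉ midUnion m ↔ ∀ i j k l : Fin m, i ≠ j → k ≠ l → i ≠ k → i ≠ l → j ≠ k → j ≠ l →
      x i + x j ≠ x k + x l := by
  simp only [midUnion, Set.mem_iUnion, Set.mem_ofPred_eq, not_exists]
  constructor
  · intro h i j k l hij hkl hik hil hjk hjl he
    wlog h1 : i < j generalizing i j
    · exact this j i hij.symm hjk hjl hik hil (by linarith) (by omega)
    wlog h2 : k < l generalizing k l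
    · exact this l k hkl.symm hil hik hjl hjk (by linarith) (by omega)
    rcases lt_or_gt_of_ne hik with h3 | h3
    · exact h i j k l h1 h3 h2 hjk hjl he
    · exact h k l i j h2 h3 h1 hil.symm hjl.symm he.symm
  · intro h i j k l h1 h2 h3 h4 h5
    exact h i j k l h1.ne h3.ne h2.ne (h2.trans h3).ne h4 h5

theorem mem_compl_midHyperplaneUnion_iff {m : ℕ} (hm : 3 ≤ m) {x : Fin m → ℝ} :
    x ∈ (midHyperplaneUnion m)ᶜ ↔ ∀ i j k l : Fin m, i ≠ j → k ≠ l →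
      x i + x j = x k + x l → s(i, j) = s(k, l) := by
  rw [Set.mem_compl_iff, midHyperplaneUnion, Set.mem_union, not_or, notMem_braidUnion_iff,
    notMem_midUnion_iff]
  constructor
  · rintro ⟨hinj, h⟩ i j k l hij hkl he
    rw [Sym2.eq_iff]
    by_cases hik : i = k
    · subst hik
      exact Or.inl ⟨rfl, hinj (by linarith)⟩
    by_cases hil : i = l
    · subst hil
      exact Or.inr ⟨rfl, hinj (by linarith)⟩
    by_cases hjk : j = k
    · subst hjk
      exact absurd (hinj (by linarith)) hil
    by_cases hjl : j = l
    · subst hjl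
      exact absurd (hinj (by linarith)) hik
    exact absurd he (h i j k l hij hkl hik hil hjk hjl)
  · intro h
    constructor
    · intro i j hij
      obtain ⟨k, hki, hkj⟩ := exists_ne_ne hm i j
      have := h k i k j hki hkj (by rw [hij])
      rcases Sym2.eq_iff.1 this with ⟨-, h1⟩ | ⟨h1, -⟩
      · exact h1
      · exact absurd h1 hkj
    · intro i j k l hij hkl hik hil hjk hjl he
      have := h i j k l hij hkl he
      rw [Sym2.eq_iff] at this
      tauto

theorem injective_of_mem_compl {m : ℕ} {x : Fin m → ℝ} (hx : x ∈ (midHyperplaneUnion m)ᶜ) :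
    Function.Injective x :=
  notMem_braidUnion_iff.1 fun h => hx (Or.inl h)

theorem C0_diff_midUnion (m : ℕ) : C0 m \ midUnion m = C0 m ∩ (midHyperplaneUnion m)ᶜ := by
  ext x
  simp only [Set.mem_sdiff, Set.mem_inter_iff, Set.mem_compl_iff, midHyperplaneUnion,
    Set.mem_union, not_or]
  exact and_congr_right fun hx =>
    ⟨fun h => ⟨notMem_braidUnion_iff.2 (StrictMono.injective hx), h⟩, fun h => h.2⟩

theorem midOrder_eq_of_imp {m : ℕ} (hm : 3 ≤ m) {y z : Fin m → ℝ}
    (hy : y ∈ (midHyperplaneUnion m)ᶜ)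
    (h : ∀ i j k l : Fin m, i ≠ j → k ≠ l → y i + y j < y k + y l → z i + z j < z k + z l) :
    z ∈ (midHyperplaneUnion m)ᶜ ∧ midOrder z = midOrder y := by
  rw [mem_compl_midHyperplaneUnion_iff hm] at hy ⊢
  constructor
  · intro i j k l hij hkl he
    rcases lt_trichotomy (y i + y j) (y k + y l) with h1 | h1 | h1
    · exact absurd he (h i j k l hij hkl h1).ne
    · exact hy i j k l hij hkl h1
    · exact absurd he (h k l i j hkl hij h1).ne'
  · rw [midOrder_eq_iff]
    refine fun i j k l hij hkl => ⟨fun hz => ?_, h i j k l hij hkl⟩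
    rcases lt_trichotomy (y i + y j) (y k + y l) with h1 | h1 | h1
    · exact h1
    · rcases Sym2.eq_iff.1 (hy i j k l hij hkl h1) with ⟨rfl, rfl⟩ | ⟨rfl, rfl⟩ <;> linarith
    · linarith [h k l i j hkl hij h1]

theorem connectedComponentIn_compl_midHyperplaneUnion {m : ℕ} (hm : 3 ≤ m) {y : Fin m → ℝ}
    (hy : y ∈ (midHyperplaneUnion m)ᶜ) :
    connectedComponentIn (midHyperplaneUnion m)ᶜ y =
      {z | z ∈ (midHyperplaneUnion m)ᶜ ∧ midOrder z = midOrder y} := by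
  apply Set.Subset.antisymm
  · intro z hz
    have hsub := connectedComponentIn_subset (midHyperplaneUnion m)ᶜ y
    refine midOrder_eq_of_imp hm hy fun i j k l hij hkl hlt => ?_
    by_contra hge
    have hg : Continuous fun w : Fin m → ℝ => w i + w j - (w k + w l) := by fun_prop
    obtain ⟨w, hw, hw0⟩ := isPreconnected_connectedComponentIn.intermediate_value
      (mem_connectedComponentIn hy) hz hg.continuousOn
      (show (0 : ℝ) ∈ Set.Icc _ _ from ⟨by linarith, by linarith⟩)
    have := (mem_compl_midHyperplaneUnion_iff hm).1 (hsub hw) i j k l hij hkl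
      (sub_eq_zero.1 hw0)
    rcases Sym2.eq_iff.1 this with ⟨rfl, rfl⟩ | ⟨rfl, rfl⟩ <;> linarith
  · have hconv : Convex ℝ {z | z ∈ (midHyperplaneUnion m)ᶜ ∧ midOrder z = midOrder y} := by
      intro u hu v hv a b ha hb hab
      refine midOrder_eq_of_imp hm hy fun i j k l hij hkl hlt => ?_
      have h1 := (midOrder_eq_iff.1 hu.2 i j k l hij hkl).2 hlt
      have h2 := (midOrder_eq_iff.1 hv.2 i j k l hij hkl).2 hlt
      simp only [Pi.add_apply, Pi.smul_apply, smul_eq_mul]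
      rcases ha.eq_or_lt with rfl | ha
      · obtain rfl : b = 1 := by linarith
        linarith
      · nlinarith [mul_lt_mul_of_pos_left h1 ha, mul_le_mul_of_nonneg_left h2.le hb]
    exact hconv.isPreconnected.subset_connectedComponentIn ⟨hy, rfl⟩ fun z hz => hz.1

theorem Set.ncard_image_eq_of_eq_iff_eq {α β γ : Type*} {s : Set α} {f : α → β} {g : α → γ}
    (h : ∀ a ∈ s, ∀ b ∈ s, f a = f b ↔ g a = g b) : (f '' s).ncard = (g '' s).ncard := by
  rcases s.eq_empty_or_nonempty with rfl | ⟨a₀, -⟩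
  · simp
  have : Nonempty α := ⟨a₀⟩
  have hsel : ∀ b ∈ f '' s, ∃ a ∈ s, f a = b := fun b hb => hb
  choose! r hrs hrf using hsel
  refine Set.ncard_congr (fun b _ => g (r b)) (fun b hb => ⟨_, hrs b hb, rfl⟩) ?_ ?_
  · intro b c hb hc hbc
    rw [← hrf b hb, ← hrf c hc]
    exact (h _ (hrs b hb) _ (hrs c hc)).2 hbc
  · rintro _ ⟨a, ha, rfl⟩
    have hfa := Set.mem_image_of_mem f ha
    exact ⟨f a, hfa, (h _ (hrs _ hfa) _ ha).1 (hrf _ hfa)⟩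

theorem ncard_chambersOf_midHyperplaneUnion {m : ℕ} (hm : 3 ≤ m) :
    (chambersOf (midHyperplaneUnion m)).ncard =
      (midOrder '' (midHyperplaneUnion m)ᶜ).ncard := by
  have : chambersOf (midHyperplaneUnion m) =
      connectedComponentIn (midHyperplaneUnion m)ᶜ '' (midHyperplaneUnion m)ᶜ := by
    ext C
    simp only [chambersOf, Set.mem_ofPred_eq, Set.mem_image, eq_comm]
  rw [this]
  refine Set.ncard_image_eq_of_eq_iff_eq fun x hx y hy => ?_
  rw [connectedComponentIn_compl_midHyperplaneUnion hm hx,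
    connectedComponentIn_compl_midHyperplaneUnion hm hy]
  refine ⟨fun h => ?_, fun h => by rw [h]⟩
  have : x ∈ {z | z ∈ (midHyperplaneUnion m)ᶜ ∧ midOrder z = midOrder x} := ⟨hx, rfl⟩
  rw [h] at this
  exact this.2

theorem abs_sub_lt_abs_sub_iff_of_lt {y a b : ℝ} (h : a < b) :
    |y - a| < |y - b| ↔ 2 * y < a + b := by
  rw [← sq_lt_sq]
  constructor <;> intro h' <;> nlinarith

theorem abs_sub_lt_abs_sub_iff_of_gt {y a b : ℝ} (h : a < b) :
    |y - b| < |y - a| ↔ a + b < 2 * y := by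
  rw [← sq_lt_sq]
  constructor <;> intro h' <;> nlinarith

theorem exists_mem_RPUF {m : ℕ} {x : Fin m → ℝ} {y : ℝ}
    (hy : Function.Injective fun i => |y - x i|) :
    ∃ σ : Equiv.Perm (Fin m), ∀ k l : Fin m, k < l → |y - x (σ k)| < |y - x (σ l)| :=
  ⟨Tuple.sort fun i => |y - x i|, fun _ _ hkl =>
    (Tuple.monotone_sort _).strictMono_of_injective (hy.comp (Equiv.injective _)) hkl⟩

theorem add_lt_add_iff_exists_mem_RPUF {m : ℕ} {x : Fin m → ℝ} (hx : StrictMono x)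
    {i j k l : Fin m} (hij : i < j) (hkl : k < l) :
    x i + x j < x k + x l ↔ ∃ σ ∈ RPUF x, σ⁻¹ j < σ⁻¹ i ∧ σ⁻¹ k < σ⁻¹ l := by
  constructor
  · intro h
    have hfin : (Set.range fun p : Fin m × Fin m => (x p.1 + x p.2) / 2).Finite :=
      Set.finite_range _
    obtain ⟨y, ⟨hy1, hy2⟩, hy3⟩ := ((Set.Ioo_infinite
      (show (x i + x j) / 2 < (x k + x l) / 2 by linarith)).sdiff hfin).nonempty
    have hinj : Function.Injective fun i => |y - x i| := by
      intro a b hab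
      rcases abs_eq_abs.1 hab with h1 | h1
      · exact hx.injective (by linarith)
      · exact absurd ⟨(a, b), by simp only; linarith⟩ hy3
    obtain ⟨σ, hσ⟩ := exists_mem_RPUF hinj
    have hσm : StrictMono fun a => |y - x (σ a)| := fun a b hab => hσ a b hab
    refine ⟨σ, ⟨y, hσ⟩, ?_, ?_⟩
    · rw [← hσm.lt_iff_lt]
      simpa using (abs_sub_lt_abs_sub_iff_of_gt (hx hij)).2 (by linarith)
    · rw [← hσm.lt_iff_lt]
      simpa using (abs_sub_lt_abs_sub_iff_of_lt (hx hkl)).2 (by linarith)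
  · rintro ⟨σ, ⟨y, hσ⟩, h1, h2⟩
    have h1 := hσ _ _ h1
    have h2 := hσ _ _ h2
    rw [Equiv.Perm.inv_def, Equiv.apply_symm_apply, Equiv.apply_symm_apply] at h1 h2
    rw [abs_sub_lt_abs_sub_iff_of_gt (hx hij)] at h1
    rw [abs_sub_lt_abs_sub_iff_of_lt (hx hkl)] at h2
    linarith

theorem RPUF_subset_of_midOrder_eq {m : ℕ} {x x' : Fin m → ℝ} (hx : StrictMono x)
    (hx' : StrictMono x') (h : midOrder x = midOrder x') : RPUF x ⊆ RPUF x' := by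
  rintro σ ⟨y, hσ⟩
  classical
  let P : Finset (Fin m × Fin m) := Finset.univ.filter fun p => p.1 < p.2
  obtain ⟨y', hlo, hhi⟩ := Order.exists_between_finsets
    ((P.filter fun p => x p.1 + x p.2 < 2 * y).image fun p => (x' p.1 + x' p.2) / 2)
    ((P.filter fun p => 2 * y < x p.1 + x p.2).image fun p => (x' p.1 + x' p.2) / 2) (by
      simp only [Finset.mem_image, Finset.mem_filter, P, Finset.mem_univ, true_and]
      rintro _ ⟨p, ⟨hp, hpy⟩, rfl⟩ _ ⟨q, ⟨hq, hqy⟩, rfl⟩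
      have := (midOrder_eq_iff_of_lt.1 h p.1 p.2 q.1 q.2 hp hq).1 (by linarith)
      linarith)
  refine ⟨y', fun k l hkl => ?_⟩
  have hlt := hσ k l hkl
  rcases lt_or_gt_of_ne (σ.injective.ne hkl.ne) with h1 | h1
  · rw [abs_sub_lt_abs_sub_iff_of_lt (hx h1)] at hlt
    rw [abs_sub_lt_abs_sub_iff_of_lt (hx' h1)]
    have := hhi _ (Finset.mem_image_of_mem _ (a := (σ k, σ l)) (by simp [P, h1, hlt]))
    simp only at this
    linarith
  · rw [abs_sub_lt_abs_sub_iff_of_gt (hx h1)] at hlt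
    rw [abs_sub_lt_abs_sub_iff_of_gt (hx' h1)]
    have := hlo _ (Finset.mem_image_of_mem _ (a := (σ l, σ k)) (by simp [P, h1, hlt]))
    simp only at this
    linarith

theorem RPUF_eq_iff_midOrder_eq {m : ℕ} {x x' : Fin m → ℝ} (hx : StrictMono x)
    (hx' : StrictMono x') : RPUF x = RPUF x' ↔ midOrder x = midOrder x' := by
  refine ⟨fun h => ?_, fun h => Set.Subset.antisymm (RPUF_subset_of_midOrder_eq hx hx' h)
    (RPUF_subset_of_midOrder_eq hx' hx h.symm)⟩
  rw [midOrder_eq_iff_of_lt]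
  intro i j k l hij hkl
  rw [add_lt_add_iff_exists_mem_RPUF hx hij hkl, add_lt_add_iff_exists_mem_RPUF hx' hij hkl, h]

theorem r0_eq_ncard_midOrder (m : ℕ) :
    r0 m = (midOrder '' (C0 m ∩ (midHyperplaneUnion m)ᶜ)).ncard := by
  have : {R : Set (Equiv.Perm (Fin m)) | ∃ x ∈ C0 m \ midUnion m, R = RPUF x} =
      RPUF '' (C0 m ∩ (midHyperplaneUnion m)ᶜ) := by
    ext R
    simp only [C0_diff_midUnion, Set.mem_ofPred_eq, Set.mem_image, eq_comm]
  rw [r0, this]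
  exact Set.ncard_image_eq_of_eq_iff_eq fun x hx y hy => RPUF_eq_iff_midOrder_eq hx.1 hy.1

theorem comp_perm_mem_compl {m : ℕ} (hm : 3 ≤ m) {x : Fin m → ℝ} (σ : Equiv.Perm (Fin m))
    (hx : x ∈ (midHyperplaneUnion m)ᶜ) : x ∘ σ ∈ (midHyperplaneUnion m)ᶜ := by
  rw [mem_compl_midHyperplaneUnion_iff hm] at hx ⊢
  intro i j k l hij hkl he
  have := hx _ _ _ _ (σ.injective.ne hij) (σ.injective.ne hkl) he
  simpa [Sym2.eq_iff] using this

theorem lt_iff_lt_of_midOrder_eq {m : ℕ} (hm : 3 ≤ m) {x x' : Fin m → ℝ}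
    (h : midOrder x = midOrder x') (i j : Fin m) : x i < x j ↔ x' i < x' j := by
  obtain ⟨k, hki, hkj⟩ := exists_ne_ne hm i j
  simpa using midOrder_eq_iff.1 h k i k j hki hkj

theorem eq_of_strictMono_of_lt_iff_lt {m : ℕ} {x x' : Fin m → ℝ} (hx : StrictMono x)
    (hx' : StrictMono x') {σ τ : Equiv.Perm (Fin m)}
    (h : ∀ i j, x (σ i) < x (σ j) ↔ x' (τ i) < x' (τ j)) : σ = τ := by
  have hmono : StrictMono (σ * τ⁻¹) := by
    intro a b hab
    have := h (τ⁻¹ a) (τ⁻¹ b)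
    simpa [hx.lt_iff_lt, hx'.lt_iff_lt, hab] using this
  have h1 : ⇑(σ * τ⁻¹) = id := by
    have := Subsingleton.elim (hmono.orderIsoOfSurjective _ (Equiv.surjective _))
      (OrderIso.refl (Fin m))
    ext a
    exact congrArg Fin.val (DFunLike.congr_fun this a)
  have h2 : σ * τ⁻¹ = 1 := Equiv.ext fun a => congrFun h1 a
  exact mul_inv_eq_one.1 h2

/-- The action of a relabelling of the coordinates on comparisons of midpoints. -/
def relabel {m : ℕ} (σ : Equiv.Perm (Fin m)) (A : Set ((Fin m × Fin m) × (Fin m × Fin m))) :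
    Set ((Fin m × Fin m) × (Fin m × Fin m)) :=
  Prod.map (Prod.map σ σ) (Prod.map σ σ) ⁻¹' A

theorem relabel_midOrder {m : ℕ} (σ : Equiv.Perm (Fin m)) (x : Fin m → ℝ) :
    relabel σ (midOrder x) = midOrder (x ∘ σ) := by
  ext ⟨⟨i, j⟩, ⟨k, l⟩⟩
  simp [relabel, mem_midOrder]

theorem relabel_injective {m : ℕ} (σ : Equiv.Perm (Fin m)) :
    Function.Injective (relabel σ) :=
  Set.preimage_injective.2 <|
    (σ.surjective.prodMap σ.surjective).prodMap (σ.surjective.prodMap σ.surjective)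

theorem image_relabel_midOrder {m : ℕ} (hm : 3 ≤ m) :
    (fun p : Set ((Fin m × Fin m) × (Fin m × Fin m)) × Equiv.Perm (Fin m) =>
      relabel p.2 p.1) '' ((midOrder '' (C0 m ∩ (midHyperplaneUnion m)ᶜ)) ×ˢ Set.univ) =
      midOrder '' (midHyperplaneUnion m)ᶜ := by
  ext A
  constructor
  · rintro ⟨⟨_, σ⟩, ⟨⟨x, hx, rfl⟩, -⟩, rfl⟩
    exact ⟨x ∘ σ, comp_perm_mem_compl hm σ hx.2, (relabel_midOrder σ x).symm⟩
  · rintro ⟨x, hx, rfl⟩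
    have hmono : StrictMono (x ∘ Tuple.sort x) := (Tuple.monotone_sort x).strictMono_of_injective
      ((injective_of_mem_compl hx).comp (Equiv.injective _))
    refine ⟨(midOrder (x ∘ Tuple.sort x), (Tuple.sort x)⁻¹),
      ⟨⟨_, ⟨hmono, comp_perm_mem_compl hm _ hx⟩, rfl⟩, trivial⟩, ?_⟩
    simp only [relabel_midOrder]
    congr 1
    ext a
    simp

theorem injOn_relabel_midOrder {m : ℕ} (hm : 3 ≤ m) :
    Set.InjOn (fun p : Set ((Fin m × Fin m) × (Fin m × Fin m)) × Equiv.Perm (Fin m) =>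
      relabel p.2 p.1) ((midOrder '' (C0 m ∩ (midHyperplaneUnion m)ᶜ)) ×ˢ Set.univ) := by
  rintro ⟨_, σ⟩ ⟨⟨x, hx, rfl⟩, -⟩ ⟨_, τ⟩ ⟨⟨x', hx', rfl⟩, -⟩ h
  simp only at h
  have h' := h
  rw [relabel_midOrder, relabel_midOrder] at h'
  obtain rfl : σ = τ := eq_of_strictMono_of_lt_iff_lt hx.1 hx'.1 (lt_iff_lt_of_midOrder_eq hm h')
  rw [relabel_injective σ h]

/-- `r_0(m) = |ch(M_m)| / m!` (Kamiya–Orlik–Takemura–Terao): the number of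
ranking patterns of unidimensional unfolding models with generic `m`-tuples
satisfying `x_1 < ⋯ < x_m` equals the number of chambers of the mid-hyperplane
arrangement `M_m` divided by `m!` (stated multiplicatively). -/
theorem r0_eq_chambers_div_factorial (m : ℕ) (hm : 3 ≤ m) :
    r0 m * Nat.factorial m = (chambersOf (midHyperplaneUnion m)).ncard := by
  rw [ncard_chambersOf_midHyperplaneUnion hm, ← image_relabel_midOrder hm,
    (injOn_relabel_midOrder hm).ncard_image, Set.ncard_prod, Set.ncard_univ,
    Nat.card_perm, Nat.card_fin, r0_eq_ncard_midOrder]
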